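/- Optimality of controlled-predictor-structured policies (finite horizon): for every horizon N ≥ 1 and initial pmf π_0, the infimum over all admissible joint coding-control policies of the expected cost E[Σ_{k=0}^{N-1} c(x_k,u_k)] equals the infimum of the same expected cost over all (time-varying) controlled-predictor policies, i.e., policies of the form Q_t = γ^e_t(π_t), q_t = Q_t(x_t), u_t = γ^c_t(π_t)(Q_t, q_t). In particular, any optimal controlled-predictor policy is optimal among all admissible policies. -/

import Mathlib

open Finset

noncomputable section

variable {X U M : Type}

/-- `π` is a probability mass function on the finite set `X`. -/
def IsPmf [Fintype X] (π : X → ℝ) : Prop :=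
  (∀ x, 0 ≤ π x) ∧ ∑ x, π x = 1

/-- Mass that `π` assigns to the cell `Q⁻¹(q)`. -/
def mass [Fintype X] [DecidableEq M] (π : X → ℝ) (Q : X → M) (q : M) : ℝ :=
  ∑ x ∈ Finset.univ.filter (fun x => Q x = q), π x

/-- One-step predictor (Bayesian) update `F(π,Q,η,q)`. -/
def Fupd [Fintype X] [DecidableEq M] (P : X → U → X → ℝ)
    (π : X → ℝ) (Q : X → M) (η : (X → M) → M → U) (q : M) : X → ℝ :=
  fun x' => (mass π Q q)⁻¹ *
    ∑ x ∈ Finset.univ.filter (fun x => Q x = q), P x (η Q q) x' * π x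

/-- Output sequence `q_{[0,t-1]}` (as a list, chronological) generated by an admissible
coding policy `γe : 𝕏^{t+1} × ℳ^t → ℳ` (encoded on lists: `γe (x_{[0,t]}) (q_{[0,t-1]})`)
along the state trajectory `xl`. -/
def admQList (γe : List X → List M → M) (xl : List X) : ℕ → List M
  | 0 => []
  | t + 1 => admQList γe xl t ++ [γe (xl.take (t + 1)) (admQList γe xl t)]

/-- Action sequence `u_{[0,t-1]}` (as a list) generated by an admissible control policy
`γc : ℳ^{t+1} × 𝕌^t → 𝕌` (encoded on lists: `γc (q_{[0,t]}) (u_{[0,t-1]})`) from the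
output sequence `ql`. -/
def admUList (γc : List M → List U → U) (ql : ℕ → List M) : ℕ → List U
  | 0 => []
  | t + 1 => admUList γc ql t ++ [γc (ql (t + 1)) (admUList γc ql t)]

/-- The action `u_t` applied at time `t` under the admissible joint policy `(γe, γc)`,
given the state trajectory `xl` (as a list). -/
def admAct (γe : List X → List M → M) (γc : List M → List U → U)
    (xl : List X) (t : ℕ) : U :=
  γc (admQList γe xl (t + 1)) (admUList γc (admQList γe xl) t)

/-- Trajectory law of `x_{[0,N-1]}` under the admissible joint policy `(γe, γc)`
(the channel outputs and actions being deterministic functions of the state path). -/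
noncomputable def admLaw [Fintype X] (P : X → U → X → ℝ)
    (γe : List X → List M → M) (γc : List M → List U → U)
    (π0 : X → ℝ) (N : ℕ) (xs : Fin N → X) : ℝ :=
  ∏ s : Fin N,
    (if (s : ℕ) = 0 then π0 (xs s)
     else
       P (xs ⟨(s : ℕ) - 1, lt_of_le_of_lt (Nat.sub_le _ _) s.isLt⟩)
         (admAct γe γc (List.ofFn xs) ((s : ℕ) - 1)) (xs s))

/-- Expected accumulated cost `E[Σ_{k=0}^{N-1} c(x_k, u_k)]` under an admissible
joint coding-control policy. -/
noncomputable def admCost [Fintype X] (P : X → U → X → ℝ) (c : X → U → ℝ)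
    (γe : List X → List M → M) (γc : List M → List U → U)
    (π0 : X → ℝ) (N : ℕ) : ℝ :=
  ∑ xs : Fin N → X,
    admLaw P γe γc π0 N xs * ∑ k : Fin N, c (xs k) (admAct γe γc (List.ofFn xs) k)

/-- Predictor process along a list of channel outputs under a *time-varying*
controlled-predictor policy `(tγe, tγc)`; the first argument is the current time. -/
noncomputable def predListTV [Fintype X] [DecidableEq M] (P : X → U → X → ℝ)
    (tγe : ℕ → (X → ℝ) → (X → M)) (tγc : ℕ → (X → ℝ) → ((X → M) → M → U)) :
    ℕ → (X → ℝ) → List M → (X → ℝ)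
  | _, π, [] => π
  | t, π, q :: qs =>
      predListTV P tγe tγc (t + 1) (Fupd P π (tγe t π) (tγc t π) q) qs

/-- The admissible coding policy induced by a time-varying controlled-predictor policy:
`Q_t = γ^e_t(π_t)` and `q_t = Q_t(x_t)`. -/
noncomputable def inducedE [Fintype X] [Nonempty X] [DecidableEq M] (P : X → U → X → ℝ)
    (tγe : ℕ → (X → ℝ) → (X → M)) (tγc : ℕ → (X → ℝ) → ((X → M) → M → U))
    (π0 : X → ℝ) : List X → List M → M :=
  fun xl ql =>
    tγe ql.length (predListTV P tγe tγc 0 π0 ql)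
      (xl.getLast?.getD (Classical.arbitrary X))

/-- The admissible control policy induced by a time-varying controlled-predictor policy:
`u_t = γ^c_t(π_t)(Q_t, q_t)`. -/
noncomputable def inducedC [Fintype X] [Nonempty M] [DecidableEq M] (P : X → U → X → ℝ)
    (tγe : ℕ → (X → ℝ) → (X → M)) (tγc : ℕ → (X → ℝ) → ((X → M) → M → U))
    (π0 : X → ℝ) : List M → List U → U :=
  fun ql _ =>
    let t := ql.length - 1
    let π := predListTV P tγe tγc 0 π0 (ql.take t)
    tγc t π (tγe t π) (ql.getLast?.getD (Classical.arbitrary M))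

/-! ### Locality of the admissible policy -/

lemma admQList_append (γe : List X → List M → M) (l r : List X) (t : ℕ) (ht : t ≤ l.length) :
    admQList γe (l ++ r) t = admQList γe l t := by
  induction t with
  | zero => rfl
  | succ t ih =>
    simp only [admQList]
    rw [ih (by omega), List.take_append_of_le_length ht]

lemma admQList_length (γe : List X → List M → M) (l : List X) (t : ℕ) :
    (admQList γe l t).length = t := by
  induction t with
  | zero => rfl
  | succ t ih => simp [admQList, ih]

lemma admUList_congr (γc : List M → List U → U) (f g : ℕ → List M) (t : ℕ)
    (h : ∀ k ≤ t, f k = g k) : admUList γc f t = admUList γc g t := by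
  induction t with
  | zero => rfl
  | succ t ih =>
    simp only [admUList]
    rw [ih (fun k hk => h k (by omega)), h (t + 1) le_rfl]

lemma admAct_append (γe : List X → List M → M) (γc : List M → List U → U) (l r : List X) (t : ℕ)
    (ht : t < l.length) : admAct γe γc (l ++ r) t = admAct γe γc l t := by
  unfold admAct
  rw [admQList_append γe l r (t + 1) ht,
    admUList_congr γc _ (admQList γe l) t
      (fun k hk => admQList_append γe l r k (by omega))]

/-! ### Recursive cost to go -/

/-- Cost to go with `n` stages left, from past `g` and current state `x`. -/
def Jgo [Fintype X] (P : X → U → X → ℝ) (c : X → U → ℝ)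
    (γe : List X → List M → M) (γc : List M → List U → U) : ℕ → List X → X → ℝ
  | 0, _, _ => 0
  | n + 1, g, x => c x (admAct γe γc (g ++ [x]) g.length) +
      ∑ x', P x (admAct γe γc (g ++ [x]) g.length) x' * Jgo P c γe γc n (g ++ [x]) x'

/-- Conditional law of the future path. -/
def futLaw (P : X → U → X → ℝ)
    (γe : List X → List M → M) (γc : List M → List U → U) (n : ℕ) (g : List X) (x : X)
    (ys : Fin n → X) : ℝ :=
  ∏ s : Fin n, P ((Fin.cons x ys : Fin (n + 1) → X) s.castSucc)
    (admAct γe γc (g ++ List.ofFn (Fin.cons x ys : Fin (n + 1) → X)) (g.length + s)) (ys s)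

/-- Accumulated cost on the future path. -/
def futCost (c : X → U → ℝ)
    (γe : List X → List M → M) (γc : List M → List U → U) (n : ℕ) (g : List X) (x : X)
    (ys : Fin n → X) : ℝ :=
  ∑ k : Fin (n + 1), c ((Fin.cons x ys : Fin (n + 1) → X) k)
    (admAct γe γc (g ++ List.ofFn (Fin.cons x ys : Fin (n + 1) → X)) (g.length + k))

lemma sum_fin_cons [Fintype X] (n : ℕ) (f : (Fin (n + 1) → X) → ℝ) :
    ∑ z, f z = ∑ x : X, ∑ ys : Fin n → X, f (Fin.cons x ys) := by
  rw [← Fintype.sum_prod_type']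
  exact (Fintype.sum_equiv (Fin.consEquiv (fun _ => X)) _ _ (fun _ => rfl)).symm

lemma ofFn_cons' (n : ℕ) (x : X) (ys : Fin n → X) :
    List.ofFn (Fin.cons x ys : Fin (n + 1) → X) = x :: List.ofFn ys := by
  simp [List.ofFn_succ]

lemma futLaw_succ (P : X → U → X → ℝ)
    (γe : List X → List M → M) (γc : List M → List U → U) (n : ℕ) (g : List X) (x y : X)
    (ys : Fin n → X) :
    futLaw P γe γc (n + 1) g x (Fin.cons y ys) =
      P x (admAct γe γc (g ++ [x]) g.length) y * futLaw P γe γc n (g ++ [x]) y ys := by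
  unfold futLaw
  have hl : g ++ List.ofFn (Fin.cons x (Fin.cons y ys : Fin (n + 1) → X) : Fin (n + 2) → X)
      = (g ++ [x]) ++ List.ofFn (Fin.cons y ys : Fin (n + 1) → X) := by
    rw [ofFn_cons']; simp
  rw [hl, Fin.prod_univ_succ]
  congr 1
  · rw [admAct_append _ _ _ _ _ (by simp)]
    simp
  · refine Finset.prod_congr rfl fun s _ => ?_
    have : g.length + ((s.succ : Fin (n + 1)) : ℕ) = (g ++ [x]).length + (s : ℕ) := by
      simp; omega
    rw [this]
    simp only [← Fin.succ_castSucc, Fin.cons_succ]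

lemma futCost_succ (c : X → U → ℝ)
    (γe : List X → List M → M) (γc : List M → List U → U) (n : ℕ) (g : List X) (x y : X)
    (ys : Fin n → X) :
    futCost c γe γc (n + 1) g x (Fin.cons y ys) =
      c x (admAct γe γc (g ++ [x]) g.length) + futCost c γe γc n (g ++ [x]) y ys := by
  unfold futCost
  have hl : g ++ List.ofFn (Fin.cons x (Fin.cons y ys : Fin (n + 1) → X) : Fin (n + 2) → X)
      = (g ++ [x]) ++ List.ofFn (Fin.cons y ys : Fin (n + 1) → X) := by
    rw [ofFn_cons']; simp
  rw [hl, Fin.sum_univ_succ]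
  congr 1
  · rw [admAct_append _ _ _ _ _ (by simp)]
    simp
  · refine Finset.sum_congr rfl fun s _ => ?_
    have : g.length + ((s.succ : Fin (n + 2)) : ℕ) = (g ++ [x]).length + (s : ℕ) := by
      simp; omega
    rw [this]
    simp only [Fin.cons_succ]

lemma sum_futLaw [Fintype X] (P : X → U → X → ℝ) (hP : ∀ x u, IsPmf (P x u))
    (γe : List X → List M → M) (γc : List M → List U → U) (n : ℕ) :
    ∀ (g : List X) (x : X), ∑ ys, futLaw P γe γc n g x ys = 1 := by
  induction n with
  | zero => intro g x; simp [futLaw]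
  | succ n ih =>
    intro g x
    rw [sum_fin_cons]
    simp only [futLaw_succ, ← Finset.mul_sum, ih, mul_one]
    exact (hP _ _).2

lemma sum_futLaw_futCost [Fintype X] (P : X → U → X → ℝ) (hP : ∀ x u, IsPmf (P x u))
    (c : X → U → ℝ)
    (γe : List X → List M → M) (γc : List M → List U → U) (n : ℕ) :
    ∀ (g : List X) (x : X), ∑ ys, futLaw P γe γc n g x ys * futCost c γe γc n g x ys
      = Jgo P c γe γc (n + 1) g x := by
  induction n with
  | zero =>
    intro g x
    simp [futLaw, futCost, Jgo, ofFn_cons']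
  | succ n ih =>
    intro g x
    rw [sum_fin_cons, Jgo]
    simp only [futLaw_succ, futCost_succ, mul_add, Finset.sum_add_distrib, mul_assoc,
      ← Finset.mul_sum, ih]
    congr 1
    simp only [← Finset.sum_mul, sum_futLaw P hP, one_mul, ← Finset.mul_sum]
    rw [(hP _ _).2, one_mul]

lemma admCost_eq [Fintype X] (P : X → U → X → ℝ) (hP : ∀ x u, IsPmf (P x u))
    (c : X → U → ℝ)
    (γe : List X → List M → M) (γc : List M → List U → U) (π0 : X → ℝ) (n : ℕ) :
    admCost P c γe γc π0 (n + 1) = ∑ x, π0 x * Jgo P c γe γc (n + 1) [] x := by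
  unfold admCost
  rw [sum_fin_cons]
  refine Finset.sum_congr rfl fun x _ => ?_
  rw [← sum_futLaw_futCost P hP, Finset.mul_sum]
  refine Finset.sum_congr rfl fun ys _ => ?_
  rw [← mul_assoc]
  congr 1
  · unfold admLaw futLaw
    rw [Fin.prod_univ_succ]
    congr 1
    refine Finset.prod_congr rfl fun s _ => ?_
    simp
    rfl
  · unfold futCost
    simp

/-! ### Unnormalized dynamic program -/

/-- Stage functional for sub-measures `k q` attached to the channel symbols. -/
def Gst [Fintype X] [Fintype M] (P : X → U → X → ℝ) (c : X → U → ℝ) (W : (X → ℝ) → ℝ)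
    (a : M → U) (k : M → X → ℝ) : ℝ :=
  ∑ q, (∑ x, k q x * c x (a q) + W (fun x' => ∑ x, k q x * P x (a q) x'))

/-- Restriction of `μ` to the cells of `Q`. -/
def cells [DecidableEq M] (Q : X → M) (μ : X → ℝ) : M → X → ℝ :=
  fun q x => if Q x = q then μ x else 0

/-- Unnormalized value function. -/
def Wv [Fintype X] [Fintype M] [DecidableEq M] (P : X → U → X → ℝ) (c : X → U → ℝ) :
    ℕ → (X → ℝ) → ℝ
  | 0, _ => 0
  | n + 1, μ => ⨅ p : (X → M) × (M → U), Gst P c (Wv P c n) p.2 (cells p.1 μ)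

/-- Superadditive and positively homogeneous. -/
def SupAddHomog {ι : Type} (W : (ι → ℝ) → ℝ) : Prop :=
  (∀ μ ν, W μ + W ν ≤ W (μ + ν)) ∧ (∀ (s : ℝ) μ, 0 ≤ s → W (s • μ) = s * W μ)

lemma SupAddHomog.sum {ι κ : Type} {W : (ι → ℝ) → ℝ} (h : SupAddHomog W) (S : Finset κ)
    (l : κ → ℝ) (hl : ∀ i, 0 ≤ l i) (k : κ → ι → ℝ) :
    ∑ i ∈ S, l i * W (k i) ≤ W (∑ i ∈ S, l i • k i) := by
  classical
  induction S using Finset.induction_on with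
  | empty =>
    have := h.2 0 0 le_rfl
    simp at this
    simp [this]
  | insert i S hi ih =>
    rw [Finset.sum_insert hi, Finset.sum_insert hi]
    refine le_trans ?_ (h.1 _ _)
    rw [h.2 _ _ (hl i)]
    linarith

lemma Gst_add [Fintype X] [Fintype M] (P : X → U → X → ℝ) (c : X → U → ℝ) {W : (X → ℝ) → ℝ}
    (h : SupAddHomog W) (a : M → U) (k k' : M → X → ℝ) :
    Gst P c W a k + Gst P c W a k' ≤ Gst P c W a (k + k') := by
  unfold Gst
  rw [← Finset.sum_add_distrib]
  refine Finset.sum_le_sum fun q _ => ?_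
  have := h.1 (fun x' => ∑ x, k q x * P x (a q) x') (fun x' => ∑ x, k' q x * P x (a q) x')
  have e : ((fun x' => ∑ x, k q x * P x (a q) x') + (fun x' => ∑ x, k' q x * P x (a q) x'))
      = fun x' => ∑ x, (k + k') q x * P x (a q) x' := by
    funext x'
    simp [add_mul, Finset.sum_add_distrib]
  rw [e] at this
  have e2 : ∑ x, (k + k') q x * c x (a q) = ∑ x, k q x * c x (a q) + ∑ x, k' q x * c x (a q) := by
    simp [add_mul, Finset.sum_add_distrib]
  rw [e2]
  linarith

lemma Gst_smul [Fintype X] [Fintype M] (P : X → U → X → ℝ) (c : X → U → ℝ) {W : (X → ℝ) → ℝ}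
    (h : SupAddHomog W) (a : M → U) (s : ℝ) (hs : 0 ≤ s) (k : M → X → ℝ) :
    Gst P c W a (s • k) = s * Gst P c W a k := by
  unfold Gst
  rw [Finset.mul_sum]
  refine Finset.sum_congr rfl fun q _ => ?_
  rw [mul_add, ← h.2 s _ hs, Finset.mul_sum]
  congr 1
  · refine Finset.sum_congr rfl fun x _ => ?_
    simp [mul_assoc]
  · congr 1
    funext x'
    simp [mul_assoc, Finset.mul_sum]

lemma Gst_sum [Fintype X] [Fintype M] (P : X → U → X → ℝ) (c : X → U → ℝ) {W : (X → ℝ) → ℝ}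
    (h : SupAddHomog W) (a : M → U) {κ : Type} (S : Finset κ)
    (l : κ → ℝ) (hl : ∀ i, 0 ≤ l i) (k : κ → M → X → ℝ) :
    ∑ i ∈ S, l i * Gst P c W a (k i) ≤ Gst P c W a (∑ i ∈ S, l i • k i) := by
  classical
  induction S using Finset.induction_on with
  | empty =>
    have := Gst_smul P c h a 0 le_rfl 0
    simp at this
    simp [this]
  | insert i S hi ih =>
    rw [Finset.sum_insert hi, Finset.sum_insert hi]
    refine le_trans ?_ (Gst_add P c h a _ _)
    rw [Gst_smul P c h a _ (hl i)]
    linarith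

section Dyn
variable [Fintype X] [Fintype U] [Fintype M] [Nonempty U] [Nonempty M] [DecidableEq M]

lemma Wv_succ_le (P : X → U → X → ℝ) (c : X → U → ℝ) (n : ℕ) (μ : X → ℝ)
    (p : (X → M) × (M → U)) :
    Wv (M := M) P c (n + 1) μ ≤ Gst P c (Wv (M := M) P c n) p.2 (cells p.1 μ) := by
  rw [Wv]
  exact ciInf_le (Set.finite_range _).bddBelow p

lemma exists_opt (P : X → U → X → ℝ) (c : X → U → ℝ) (n : ℕ) (μ : X → ℝ) :
    ∃ p : (X → M) × (M → U),
      Gst P c (Wv (M := M) P c n) p.2 (cells p.1 μ) = Wv (M := M) P c (n + 1) μ := by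
  rw [Wv]
  exact exists_eq_ciInf_of_finite

lemma cells_smul (Q : X → M) (s : ℝ) (μ : X → ℝ) : cells Q (s • μ) = s • cells Q μ := by
  funext q x; simp [cells]

lemma cells_add (Q : X → M) (μ ν : X → ℝ) : cells Q (μ + ν) = cells Q μ + cells Q ν := by
  funext q x; simp only [cells, Pi.add_apply]; split_ifs <;> simp

lemma Wv_supAddHomog (P : X → U → X → ℝ) (c : X → U → ℝ) (n : ℕ) :
    SupAddHomog (Wv (M := M) P c n) := by
  induction n with
  | zero => constructor <;> intros <;> simp [Wv]
  | succ n ih =>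
    constructor
    · intro μ ν
      obtain ⟨p, hp⟩ := exists_opt (M := M) P c n (μ + ν)
      rw [← hp, cells_add]
      exact le_trans (add_le_add (Wv_succ_le P c n μ p) (Wv_succ_le P c n ν p))
        (Gst_add P c ih _ _ _)
    · intro s μ hs
      apply le_antisymm
      · obtain ⟨p, hp⟩ := exists_opt (M := M) P c n μ
        rw [← hp, ← Gst_smul P c ih _ s hs, ← cells_smul]
        exact Wv_succ_le P c n _ p
      · obtain ⟨p, hp⟩ := exists_opt (M := M) P c n (s • μ)
        rw [← hp, cells_smul, Gst_smul P c ih _ s hs]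
        exact mul_le_mul_of_nonneg_left (Wv_succ_le P c n μ p) hs

/-- Deterministic quantizers are as good as randomized ones. -/
lemma Wv_le_mixture [DecidableEq X] (P : X → U → X → ℝ) (c : X → U → ℝ) (n : ℕ) (a : M → U)
    (K : M → X → ℝ) (hK : ∀ q x, 0 ≤ K q x) (μ : X → ℝ) (hμ : ∀ x, μ x = ∑ q, K q x) :
    Wv (M := M) P c (n + 1) μ ≤ Gst P c (Wv (M := M) P c n) a K := by
  obtain ⟨q0⟩ := ‹Nonempty M›
  have : Nonempty M := ⟨q0⟩
  have hμ0 : ∀ x, 0 ≤ μ x := fun x => by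
    rw [hμ]; exact Finset.sum_nonneg fun q _ => hK q x
  let kern : X → M → ℝ := fun x q => if μ x = 0 then (if q = q0 then 1 else 0) else K q x / μ x
  have hk0 : ∀ x q, 0 ≤ kern x q := by
    intro x q
    simp only [kern]
    split_ifs
    · exact zero_le_one
    · exact le_rfl
    · exact div_nonneg (hK q x) (hμ0 x)
  have hk1 : ∀ x, ∑ q, kern x q = 1 := by
    intro x
    by_cases h : μ x = 0
    · simp [kern, h]
    · simp only [kern, h, if_false]
      rw [← Finset.sum_div, ← hμ, div_self h]
  have hkm : ∀ x q, μ x * kern x q = K q x := by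
    intro x q
    by_cases h : μ x = 0
    · have h' := h
      rw [hμ, Finset.sum_eq_zero_iff_of_nonneg (fun q _ => hK q x)] at h'
      rw [h, h' q (Finset.mem_univ _), zero_mul]
    · simp only [kern, h, if_false]
      field_simp
  let l : (X → M) → ℝ := fun Q => ∏ x, kern x (Q x)
  have hl0 : ∀ Q, 0 ≤ l Q := fun Q => Finset.prod_nonneg fun x _ => hk0 x _
  have hl1 : ∑ Q, l Q = 1 := by
    have := Finset.prod_univ_sum (fun _ : X => (Finset.univ : Finset M)) kern
    simp only [hk1, Finset.prod_const_one, Fintype.piFinset_univ] at this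
    exact this.symm
  have hlm : ∀ x0 q, (∑ Q : X → M, if Q x0 = q then l Q else 0) = kern x0 q := by
    intro x0 q
    have := Finset.prod_univ_sum (fun _ : X => (Finset.univ : Finset M))
      (fun x q' => if x = x0 then (if q' = q then kern x q' else 0) else kern x q')
    rw [Fintype.piFinset_univ] at this
    have e1 : (∏ x, ∑ q', (if x = x0 then (if q' = q then kern x q' else 0) else kern x q'))
        = kern x0 q := by
      rw [Finset.prod_eq_single x0]
      · simp
      · intro x _ hx; simp [hx, hk1]
      · simp
    rw [e1] at this
    rw [this]
    refine Finset.sum_congr rfl fun Q _ => ?_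
    by_cases h : Q x0 = q
    · rw [if_pos h]
      refine Finset.prod_congr rfl fun x _ => ?_
      by_cases hx : x = x0
      · subst hx; simp [h]
      · simp [hx]
    · rw [if_neg h]
      symm
      apply Finset.prod_eq_zero (Finset.mem_univ x0)
      simp [h]
  have hdec : K = ∑ Q : X → M, l Q • cells Q μ := by
    funext q x
    simp only [Finset.sum_apply, Pi.smul_apply, smul_eq_mul, cells]
    rw [← hkm, ← hlm, Finset.mul_sum]
    refine Finset.sum_congr rfl fun Q _ => ?_
    split_ifs <;> ring
  calc Wv (M := M) P c (n + 1) μ = ∑ Q : X → M, l Q * Wv (M := M) P c (n + 1) μ := by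
        rw [← Finset.sum_mul, hl1, one_mul]
    _ ≤ ∑ Q : X → M, l Q * Gst P c (Wv (M := M) P c n) a (cells Q μ) :=
        Finset.sum_le_sum fun Q _ =>
          mul_le_mul_of_nonneg_left (Wv_succ_le P c n μ (Q, a)) (hl0 Q)
    _ ≤ Gst P c (Wv (M := M) P c n) a (∑ Q : X → M, l Q • cells Q μ) :=
        Gst_sum P c (Wv_supAddHomog P c n) a _ l hl0 _
    _ = _ := by rw [← hdec]

end Dyn

/-! ### Families of weighted paths -/

/-- Marginal of the weights `w` under `x`. -/
def marg {ι : Type} [Fintype ι] [DecidableEq X] (w : ι → ℝ) (x : ι → X) : X → ℝ :=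
  fun y => ∑ i, if x i = y then w i else 0

lemma marg_nonneg {ι : Type} [Fintype ι] [DecidableEq X] (w : ι → ℝ) (x : ι → X)
    (hw : ∀ i, 0 ≤ w i) (y : X) : 0 ≤ marg w x y :=
  Finset.sum_nonneg fun i _ => by split_ifs <;> simp [hw]

lemma sum_marg_mul {ι : Type} [Fintype ι] [Fintype X] [DecidableEq X] (w : ι → ℝ) (x : ι → X)
    (f : X → ℝ) : ∑ y, marg w x y * f y = ∑ i, w i * f (x i) := by
  unfold marg
  simp only [Finset.sum_mul]
  rw [Finset.sum_comm]
  refine Finset.sum_congr rfl fun i _ => ?_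
  simp [ite_mul]

/-- Weights restricted to the symbol `q`. -/
def resW {ι : Type} [DecidableEq M] (w : ι → ℝ) (φ : ι → M) (q : M) : ι → ℝ :=
  fun i => if φ i = q then w i else 0

/-- Weights of one-step extensions of paths with symbol `q`. -/
def extW {ι : Type} [DecidableEq M] (P : X → U → X → ℝ) (a : M → U) (w : ι → ℝ) (x : ι → X)
    (φ : ι → M) (q : M) : ι × X → ℝ :=
  fun j => resW w φ q j.1 * P (x j.1) (a q) j.2

lemma marg_extW {ι : Type} [Fintype ι] [Fintype X] [DecidableEq X] [DecidableEq M]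
    (P : X → U → X → ℝ) (a : M → U) (w : ι → ℝ) (x : ι → X) (φ : ι → M) (q : M) :
    marg (extW P a w x φ q) Prod.snd
      = fun x' => ∑ y, marg (resW w φ q) x y * P y (a q) x' := by
  funext x'
  rw [sum_marg_mul (resW w φ q) x (fun y => P y (a q) x')]
  simp only [marg, extW]
  rw [Fintype.sum_prod_type]
  simp

lemma Jgo_step {ι : Type} [Fintype ι] [Fintype X] [Fintype M] [DecidableEq X] [DecidableEq M]
    (P : X → U → X → ℝ) (c : X → U → ℝ)
    (γe : List X → List M → M) (γc : List M → List U → U) (n : ℕ)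
    (w : ι → ℝ) (g : ι → List X) (x : ι → X) (φ : ι → M) (a : M → U)
    (hact : ∀ i, w i ≠ 0 → admAct γe γc (g i ++ [x i]) (g i).length = a (φ i)) :
    ∑ i, w i * Jgo P c γe γc (n + 1) (g i) (x i) =
      ∑ q, (∑ y, marg (resW w φ q) x y * c y (a q) +
        ∑ j : ι × X, extW P a w x φ q j * Jgo P c γe γc n (g j.1 ++ [x j.1]) j.2) := by
  simp only [sum_marg_mul (resW w φ _) x (fun y => c y (a _)), Fintype.sum_prod_type, extW, resW,
    ← Finset.sum_add_distrib]
  rw [Finset.sum_comm]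
  refine Finset.sum_congr rfl fun i _ => ?_
  rw [Finset.sum_eq_single (φ i)]
  · by_cases h : w i = 0
    · simp [h]
    · rw [Jgo, hact i h, mul_add, Finset.mul_sum]
      simp [mul_assoc]
  · intro q _ hq
    simp [Ne.symm hq]
  · simp

lemma sum_resW_marg {ι : Type} [Fintype ι] [Fintype M] [DecidableEq X] [DecidableEq M]
    (w : ι → ℝ) (x : ι → X) (φ : ι → M) (y : X) :
    marg w x y = ∑ q, marg (resW w φ q) x y := by
  simp only [marg, resW]
  rw [Finset.sum_comm]
  refine Finset.sum_congr rfl fun i _ => ?_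
  split_ifs <;> simp

lemma extW_nonneg {ι : Type} [Fintype X] [DecidableEq M]
    (P : X → U → X → ℝ) (hP : ∀ x u, IsPmf (P x u)) (a : M → U) (w : ι → ℝ) (hw : ∀ i, 0 ≤ w i)
    (x : ι → X) (φ : ι → M) (q : M) (j : ι × X) : 0 ≤ extW P a w x φ q j := by
  unfold extW resW
  refine mul_nonneg ?_ ((hP _ _).1 _)
  split_ifs
  · exact hw _
  · exact le_rfl

lemma extW_ne {ι : Type} [DecidableEq M]
    (P : X → U → X → ℝ) (a : M → U) (w : ι → ℝ)
    (x : ι → X) (φ : ι → M) (q : M) (j : ι × X) (h : extW P a w x φ q j ≠ 0) :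
    w j.1 ≠ 0 ∧ φ j.1 = q := by
  unfold extW resW at h
  by_cases hq : φ j.1 = q
  · refine ⟨fun h0 => h ?_, hq⟩
    simp [h0]
  · simp [hq] at h

/-- Lower bound for every admissible policy. -/
lemma lower [Fintype X] [Fintype U] [Fintype M] [Nonempty U] [Nonempty M]
    [DecidableEq X] [DecidableEq M]
    (P : X → U → X → ℝ) (hP : ∀ x u, IsPmf (P x u)) (c : X → U → ℝ)
    (γe : List X → List M → M) (γc : List M → List U → U) (n : ℕ) :
    ∀ {ι : Type} [Fintype ι] (w : ι → ℝ) (g : ι → List X) (x : ι → X) (t : ℕ)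
      (ql : List M) (ul : List U) (_ : ∀ i, 0 ≤ w i)
      (_ : ∀ i, w i ≠ 0 → (g i).length = t ∧ admQList γe (g i ++ [x i]) t = ql ∧
        admUList γc (admQList γe (g i ++ [x i])) t = ul),
      Wv (M := M) P c n (marg w x) ≤ ∑ i, w i * Jgo P c γe γc n (g i) (x i) := by
  induction n with
  | zero => intros; simp [Wv, Jgo]
  | succ n ih =>
    intro ι _ w g x t ql ul hw hh
    let φ : ι → M := fun i => γe (g i ++ [x i]) ql
    let a : M → U := fun q => γc (ql ++ [q]) ul
    have hq1 : ∀ i, w i ≠ 0 → admQList γe (g i ++ [x i]) (t + 1) = ql ++ [φ i] := by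
      intro i hi
      obtain ⟨h1, h2, h3⟩ := hh i hi
      simp only [admQList, h2, φ]
      rw [List.take_of_length_le (by simp [h1])]
    have hact : ∀ i, w i ≠ 0 → admAct γe γc (g i ++ [x i]) (g i).length = a (φ i) := by
      intro i hi
      obtain ⟨h1, h2, h3⟩ := hh i hi
      simp only [admAct, h1, h3, hq1 i hi, a]
    rw [Jgo_step P c γe γc n w g x φ a hact]
    refine le_trans (Wv_le_mixture P c n a (fun q => marg (resW w φ q) x) ?_ _
      (sum_resW_marg w x φ)) ?_
    · intro q y
      refine marg_nonneg _ _ (fun i => ?_) _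
      unfold resW
      split_ifs <;> simp [hw]
    · unfold Gst
      refine Finset.sum_le_sum fun q _ => ?_
      refine add_le_add le_rfl ?_
      rw [← marg_extW]
      refine ih (extW P a w x φ q) (fun j => g j.1 ++ [x j.1]) Prod.snd (t + 1) (ql ++ [q])
        (ul ++ [a q]) (extW_nonneg P hP a w hw x φ q) ?_
      intro j hj
      obtain ⟨hj1, hj2⟩ := extW_ne P a w x φ q j hj
      obtain ⟨h1, h2, h3⟩ := hh _ hj1
      have hQ : admQList γe (g j.1 ++ [x j.1] ++ [j.2]) (t + 1) = ql ++ [q] := by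
        rw [admQList_append _ _ _ _ (by simp [h1]), hq1 _ hj1, hj2]
      refine ⟨by simp [h1], hQ, ?_⟩
      have hU : admUList γc (admQList γe (g j.1 ++ [x j.1] ++ [j.2])) t = ul := by
        rw [← h3]
        exact admUList_congr _ _ _ _ fun k hk => admQList_append _ _ _ _ (by simp [h1]; omega)
      simp only [admUList, hU, hQ, a]

/-! ### The optimal predictor policy -/

lemma predListTV_append [Fintype X] [DecidableEq M] (P : X → U → X → ℝ)
    (e : ℕ → (X → ℝ) → (X → M)) (f : ℕ → (X → ℝ) → ((X → M) → M → U)) (l : List M) (q : M) :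
    ∀ (t : ℕ) (π : X → ℝ), predListTV P e f t π (l ++ [q]) =
      Fupd P (predListTV P e f t π l) (e (t + l.length) (predListTV P e f t π l))
        (f (t + l.length) (predListTV P e f t π l)) q := by
  induction l with
  | nil => intro t π; simp [predListTV]
  | cons b l ih =>
    intro t π
    simp only [List.cons_append, predListTV, ih, List.length_cons]
    rw [show t + 1 + l.length = t + (l.length + 1) by omega]

lemma mass_smul_Fupd [Fintype X] [DecidableEq M] (P : X → U → X → ℝ)
    (π : X → ℝ) (hπ : ∀ x, 0 ≤ π x) (Q : X → M) (η : (X → M) → M → U) (q : M) :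
    mass π Q q • Fupd P π Q η q = fun x' => ∑ x, cells Q π q x * P x (η Q q) x' := by
  funext x'
  simp only [Pi.smul_apply, smul_eq_mul, Fupd, cells, ite_mul, zero_mul]
  rw [← Finset.sum_filter]
  by_cases h : mass π Q q = 0
  · rw [h, zero_mul]
    symm
    refine Finset.sum_eq_zero fun x hx => ?_
    unfold mass at h
    rw [Finset.sum_eq_zero_iff_of_nonneg (fun x _ => hπ x)] at h
    rw [h x hx, zero_mul]
  · rw [← mul_assoc, mul_inv_cancel₀ h, one_mul]
    exact Finset.sum_congr rfl fun x _ => mul_comm _ _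

lemma mass_nonneg [Fintype X] [DecidableEq M] 
    (π : X → ℝ) (hπ : ∀ x, 0 ≤ π x) (Q : X → M) (q : M) : 0 ≤ mass π Q q :=
  Finset.sum_nonneg fun x _ => hπ x

lemma Fupd_nonneg [Fintype X] [DecidableEq M] (P : X → U → X → ℝ) (hP : ∀ x u, IsPmf (P x u))
    (π : X → ℝ) (hπ : ∀ x, 0 ≤ π x) (Q : X → M) (η : (X → M) → M → U) (q : M) (x : X) :
    0 ≤ Fupd P π Q η q x :=
  mul_nonneg (inv_nonneg.2 (mass_nonneg π hπ Q q))
    (Finset.sum_nonneg fun y _ => mul_nonneg ((hP _ _).1 _) (hπ y))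

lemma marg_resW_cells {ι : Type} [Fintype ι] [DecidableEq X] [DecidableEq M]
    (w : ι → ℝ) (x : ι → X) (Q : X → M) (q : M) :
    marg (resW w (fun i => Q (x i)) q) x = cells Q (marg w x) q := by
  funext y
  simp only [marg, resW, cells]
  by_cases h : Q y = q
  · rw [if_pos h]
    refine Finset.sum_congr rfl fun i _ => ?_
    by_cases hi : x i = y
    · simp [hi, h]
    · simp [hi]
  · rw [if_neg h]
    refine Finset.sum_eq_zero fun i _ => ?_
    by_cases hi : x i = y
    · simp [hi, h]
    · simp [hi]

lemma upper [Fintype X] [Fintype U] [Fintype M] [Nonempty X] [Nonempty U] [Nonempty M]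
    [DecidableEq X] [DecidableEq M]
    (P : X → U → X → ℝ) (hP : ∀ x u, IsPmf (P x u)) (c : X → U → ℝ) (π0 : X → ℝ) (N : ℕ)
    (e : ℕ → (X → ℝ) → (X → M)) (f : ℕ → (X → ℝ) → ((X → M) → M → U))
    (hopt : ∀ t n π, t + (n + 1) = N →
      Gst P c (Wv (M := M) P c n) (f t π (e t π)) (cells (e t π) π) = Wv (M := M) P c (n + 1) π)
    (n : ℕ) :
    ∀ {ι : Type} [Fintype ι] (w : ι → ℝ) (g : ι → List X) (x : ι → X) (t : ℕ)
      (ql : List M) (s : ℝ) (_ : t + n = N) (_ : 0 ≤ s) (_ : ql.length = t)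
      (_ : ∀ y, 0 ≤ predListTV P e f 0 π0 ql y)
      (_ : marg w x = s • predListTV P e f 0 π0 ql)
      (_ : ∀ i, w i ≠ 0 → (g i).length = t ∧
        admQList (inducedE P e f π0) (g i ++ [x i]) t = ql),
      ∑ i, w i * Jgo P c (inducedE P e f π0) (inducedC P e f π0) n (g i) (x i)
        = Wv (M := M) P c n (marg w x) := by
  induction n with
  | zero => intros; simp [Wv, Jgo]
  | succ n ih =>
    intro ι _ w g x t ql s hN hs hql hpos hm hh
    set π := predListTV P e f 0 π0 ql with hπ
    let Q : X → M := e t π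
    let φ : ι → M := fun i => Q (x i)
    let a : M → U := f t π Q
    have hq1 : ∀ i, w i ≠ 0 →
        admQList (inducedE P e f π0) (g i ++ [x i]) (t + 1) = ql ++ [φ i] := by
      intro i hi
      obtain ⟨h1, h2⟩ := hh i hi
      simp only [admQList, h2]
      rw [List.take_of_length_le (by simp [h1])]
      simp [inducedE, hql, φ, Q, ← hπ]
    have hact : ∀ i, w i ≠ 0 →
        admAct (inducedE P e f π0) (inducedC P e f π0) (g i ++ [x i]) (g i).length
          = a (φ i) := by
      intro i hi
      obtain ⟨h1, h2⟩ := hh i hi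
      simp only [admAct, h1, hq1 i hi]
      have htk : (ql ++ [φ i]).take t = ql := by rw [← hql]; simp
      have hln : (ql ++ [φ i]).length - 1 = t := by simp [hql]
      simp only [inducedC, hln, htk, ← hπ]
      simp [a, Q]
    rw [Jgo_step P c _ _ n w g x φ a hact]
    have hW : Wv (M := M) P c (n + 1) (marg w x)
        = Gst P c (Wv (M := M) P c n) a (cells Q (marg w x)) := by
      rw [hm, (Wv_supAddHomog P c (n + 1)).2 s _ hs, cells_smul,
        Gst_smul P c (Wv_supAddHomog P c n) _ s hs, hopt t n π hN]
    rw [hW]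
    unfold Gst
    refine Finset.sum_congr rfl fun q _ => ?_
    have hc : marg (resW w φ q) x = cells Q (marg w x) q := marg_resW_cells w x Q q
    rw [← hc, ← marg_extW]
    congr 1
    have hpred : predListTV P e f 0 π0 (ql ++ [q]) = Fupd P π Q (f t π) q := by
      rw [predListTV_append, ← hπ, zero_add, hql]
    refine ih (extW P a w x φ q) (fun j => g j.1 ++ [x j.1]) Prod.snd (t + 1) (ql ++ [q])
      (s * mass π Q q) (by omega) (mul_nonneg hs (mass_nonneg π hpos Q q)) (by simp [hql])
      ?_ ?_ ?_
    · rw [hpred]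
      exact Fupd_nonneg P hP π hpos Q _ q
    · rw [hpred, mul_smul, mass_smul_Fupd P π hpos, marg_extW, hc, hm, cells_smul]
      funext x'
      simp [Finset.mul_sum, mul_assoc, a]
    · intro j hj
      obtain ⟨hj1, hj2⟩ := extW_ne P a w x φ q j hj
      obtain ⟨h1, h2⟩ := hh _ hj1
      refine ⟨by simp [h1], ?_⟩
      rw [admQList_append _ _ _ _ (by simp [h1]), hq1 _ hj1, hj2]

lemma marg_id [Fintype X] [DecidableEq X] (π : X → ℝ) : marg π (fun x => x) = π := by
  funext y; simp [marg]

lemma exists_optimal [Fintype X] [Fintype U] [Fintype M]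
    [Nonempty X] [Nonempty U] [Nonempty M] [DecidableEq X] [DecidableEq M]
    (P : X → U → X → ℝ) (hP : ∀ x u, IsPmf (P x u)) (c : X → U → ℝ)
    (π0 : X → ℝ) (hπ0 : IsPmf π0) (N : ℕ) (hN : 1 ≤ N) :
    ∃ p : (ℕ → (X → ℝ) → (X → M)) × (ℕ → (X → ℝ) → ((X → M) → M → U)),
      ∀ γ : (List X → List M → M) × (List M → List U → U),
        admCost P c (inducedE P p.1 p.2 π0) (inducedC P p.1 p.2 π0) π0 N ≤
          admCost P c γ.1 γ.2 π0 N := by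
  choose opt hopt using exists_opt (M := M) P c
  refine ⟨(fun t π => (opt (N - t - 1) π).1, fun t π _ => (opt (N - t - 1) π).2), fun γ => ?_⟩
  obtain ⟨m, rfl⟩ : ∃ m, N = m + 1 := ⟨N - 1, by omega⟩
  rw [admCost_eq P hP, admCost_eq P hP]
  have hu := upper P hP c π0 (m + 1) (fun t π => (opt (m + 1 - t - 1) π).1)
    (fun t π _ => (opt (m + 1 - t - 1) π).2) (by
      intro t n π h
      have : m + 1 - t - 1 = n := by omega
      simp only [this]
      exact hopt n π) (m + 1) π0 (fun _ => []) (fun x => x) 0 [] 1 (by omega) zero_le_one rfl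
      (by simpa [predListTV] using hπ0.1) (by simp [predListTV, marg_id])
      (by intro i _; simp [admQList])
  have hl := lower P hP c γ.1 γ.2 (m + 1) π0 (fun _ => []) (fun x => x) 0 [] [] hπ0.1
    (by intro i _; simp [admQList, admUList])
  exact hu.trans_le hl

/-- Optimality of controlled-predictor-structured policies (finite
horizon): for every horizon `N ≥ 1` and initial pmf `π_0`, the infimum over all
admissible joint coding-control policies of `E[Σ_{k=0}^{N-1} c(x_k,u_k)]` equals the
infimum of the same expected cost over all (time-varying) controlled-predictor
policies, i.e. policies of the form `Q_t = γ^e_t(π_t)`, `q_t = Q_t(x_t)`,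
`u_t = γ^c_t(π_t)(Q_t, q_t)`. In particular, any optimal controlled-predictor policy
is optimal among all admissible policies. -/
theorem controlled_predictor_policies_optimal
    [Fintype X] [Fintype U] [Fintype M]
    [Nonempty X] [Nonempty U] [Nonempty M] [DecidableEq X] [DecidableEq M]
    (P : X → U → X → ℝ) (hP : ∀ x u, IsPmf (P x u)) (c : X → U → ℝ)
    (π0 : X → ℝ) (hπ0 : IsPmf π0) (N : ℕ) (hN : 1 ≤ N) :
    ((⨅ γ : (List X → List M → M) × (List M → List U → U),
        admCost P c γ.1 γ.2 π0 N)
      = ⨅ p : (ℕ → (X → ℝ) → (X → M)) × (ℕ → (X → ℝ) → ((X → M) → M → U)),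
          admCost P c (inducedE P p.1 p.2 π0) (inducedC P p.1 p.2 π0) π0 N)
    ∧
    (∀ p : (ℕ → (X → ℝ) → (X → M)) × (ℕ → (X → ℝ) → ((X → M) → M → U)),
      (∀ p' : (ℕ → (X → ℝ) → (X → M)) × (ℕ → (X → ℝ) → ((X → M) → M → U)),
          admCost P c (inducedE P p.1 p.2 π0) (inducedC P p.1 p.2 π0) π0 N ≤
            admCost P c (inducedE P p'.1 p'.2 π0) (inducedC P p'.1 p'.2 π0) π0 N) →
      ∀ γ : (List X → List M → M) × (List M → List U → U),
        admCost P c (inducedE P p.1 p.2 π0) (inducedC P p.1 p.2 π0) π0 N ≤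
          admCost P c γ.1 γ.2 π0 N) := by
  obtain ⟨p0, hp0⟩ := exists_optimal (M := M) P hP c π0 hπ0 N hN
  constructor
  · have h1 : (⨅ γ : (List X → List M → M) × (List M → List U → U),
        admCost P c γ.1 γ.2 π0 N)
        = admCost P c (inducedE P p0.1 p0.2 π0) (inducedC P p0.1 p0.2 π0) π0 N := by
      apply le_antisymm
      · exact ciInf_le ⟨_, by rintro _ ⟨γ, rfl⟩; exact hp0 γ⟩
          ((inducedE P p0.1 p0.2 π0, inducedC P p0.1 p0.2 π0) :
            (List X → List M → M) × (List M → List U → U))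
      · exact le_ciInf hp0
    rw [h1]
    apply le_antisymm
    · exact le_ciInf fun p => hp0 (inducedE P p.1 p.2 π0, inducedC P p.1 p.2 π0)
    · exact ciInf_le ⟨admCost P c (inducedE P p0.1 p0.2 π0) (inducedC P p0.1 p0.2 π0) π0 N, by
        rintro _ ⟨p, rfl⟩
        exact hp0 (inducedE P p.1 p.2 π0, inducedC P p.1 p.2 π0)⟩ p0
  · intro p hp γ
    exact (hp p0).trans (hp0 γ)

end
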